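/- Let h ∈ PCLSC_q(B) be touching. Then: (a) h⊛ ≥ q_L on B; (b) {b ∈ B : h⊛(b) = q_L(b)} = {b ∈ B : h(b) = q_L(b)}, and this set is nonempty, closed, stably r_L-dense in B and maximally L-positive; (c) h⊛ is touching. -/

import Mathlib

noncomputable section

variable {B : Type*} [NormedAddCommGroup B] [NormedSpace ℝ B]

/-- The quadratic form `q_L b = (1/2)⟨b, Lb⟩` of a Banach SN space. -/
def qL (L : B →L[ℝ] (B →L[ℝ] ℝ)) (b : B) : ℝ := (1 / 2) * L b b

/-- `r_L = (1/2)‖·‖² + q_L`. -/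
def rL (L : B →L[ℝ] (B →L[ℝ] ℝ)) (b : B) : ℝ := (1 / 2) * ‖b‖ ^ 2 + qL L b

/-- `L` is an SN map: `‖L‖ ≤ 1` and `⟨b, Lc⟩ = ⟨c, Lb⟩`. -/
def IsSN (L : B →L[ℝ] (B →L[ℝ] ℝ)) : Prop := ‖L‖ ≤ 1 ∧ ∀ b c : B, L c b = L b c

/-- `f` is a proper convex function `B → (-∞, ∞]` with `f ≥ q_L` on `B`. -/
def PCq (L : B →L[ℝ] (B →L[ℝ] ℝ)) (f : B → EReal) : Prop :=
  (∃ b, f b ≠ ⊤) ∧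
  (∀ x y : B, ∀ t : ℝ, 0 ≤ t → t ≤ 1 →
    f (t • x + (1 - t) • y) ≤ (t : EReal) * f x + ((1 - t : ℝ) : EReal) * f y) ∧
  ∀ b, (qL L b : EReal) ≤ f b

/-- The Fenchel conjugate `f*(b*) = sup_b [⟨b, b*⟩ - f b]`. -/
def fconj (f : B → EReal) (p : B →L[ℝ] ℝ) : EReal := ⨆ b : B, ((p b : ℝ) : EReal) - f b

/-- `f⊛(b) := f*(Lb)`. -/
def fconjL (L : B →L[ℝ] (B →L[ℝ] ℝ)) (f : B → EReal) (b : B) : EReal := fconj f (L b)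

/-- `A` is an `L`-positive subset of `B`. -/
def LPositive (L : B →L[ℝ] (B →L[ℝ] ℝ)) (A : Set B) : Prop :=
  A.Nonempty ∧ ∀ a ∈ A, ∀ c ∈ A, 0 ≤ qL L (a - c)

/-- `A` is maximally `L`-positive. -/
def MaxLPositive (L : B →L[ℝ] (B →L[ℝ] ℝ)) (A : Set B) : Prop :=
  LPositive L A ∧ ∀ A' : Set B, LPositive L A' → A ⊆ A' → A' = A

/-- `A` is `r_L`-dense in `B`: for all `c`, `inf_{a ∈ A} r_L(a - c) ≤ 0`. -/
def RDense (L : B →L[ℝ] (B →L[ℝ] ℝ)) (A : Set B) : Prop :=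
  ∀ c : B, (⨅ a ∈ A, ((rL L (a - c) : ℝ) : EReal)) ≤ 0

/-- `A` is stably `r_L`-dense in `B`. -/
def StablyRDense (L : B →L[ℝ] (B →L[ℝ] ℝ)) (A : Set B) : Prop :=
  ∀ c : B, ∃ K : ℝ, 0 ≤ K ∧
    (⨅ a ∈ {a ∈ A | ‖a - c‖ ≤ K}, ((rL L (a - c) : ℝ) : EReal)) ≤ 0

/-- `f` is touching. -/
def Touching (L : B →L[ℝ] (B →L[ℝ] ℝ)) (f : B → EReal) : Prop :=
  PCq L f ∧
    ∀ c : B, (⨅ d : B, ((f d - (qL L d : EReal)) + ((rL L (d - c) : ℝ) : EReal))) ≤ 0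

/-- The function `s_L` on `B*`. -/
def sL (L : B →L[ℝ] (B →L[ℝ] ℝ)) (p : B →L[ℝ] ℝ) : EReal :=
  ⨆ c : B, ((p c - qL L c - (1 / 2) * ‖L c - p‖ ^ 2 : ℝ) : EReal)

/-- The Fitzpatrick-type function `Φ_A`. -/
def PhiA (L : B →L[ℝ] (B →L[ℝ] ℝ)) (A : Set B) (b : B) : EReal :=
  ⨆ a ∈ A, ((L b a - qL L a : ℝ) : EReal)

/-- `Θ_A` on `B*`. -/
def ThetaA (L : B →L[ℝ] (B →L[ℝ] ℝ)) (A : Set B) (p : B →L[ℝ] ℝ) : EReal :=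
  ⨆ a ∈ A, ((p a - qL L a : ℝ) : EReal)

section BanachSN

variable {L : B →L[ℝ] (B →L[ℝ] ℝ)} {h : B → EReal}

lemma EReal.coe_le_of_forall_pos_sub_le {a : ℝ} {y : EReal}
    (H : ∀ ε : ℝ, 0 < ε → ((a - ε : ℝ) : EReal) ≤ y) : (a : EReal) ≤ y := by
  refine le_of_forall_lt fun z hz => ?_
  obtain ⟨r, hzr, hra⟩ := EReal.lt_iff_exists_real_btwn.1 hz
  have := H (a - r) (_root_.sub_pos.2 (EReal.coe_lt_coe_iff.1 hra))
  rw [sub_sub_cancel] at this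
  exact hzr.trans_le this

lemma EReal.nonpos_of_forall_pos_le {y : EReal}
    (H : ∀ ε : ℝ, 0 < ε → y ≤ (ε : EReal)) : y ≤ 0 := by
  refine le_of_forall_gt fun z hz => ?_
  obtain ⟨r, hr, hrz⟩ := EReal.lt_iff_exists_real_btwn.1 hz
  exact (H r (by exact_mod_cast hr)).trans_lt hrz

lemma LowerSemicontinuous.le_of_tendsto_of_le {X : Type*} [TopologicalSpace X] {f : X → EReal}
    (hf : LowerSemicontinuous f) {d : ℕ → X} {x : ℕ → ℝ} {a : X} {y : ℝ}
    (hd : Filter.Tendsto d Filter.atTop (nhds a))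
    (hx : Filter.Tendsto x Filter.atTop (nhds y)) (hle : ∀ n, f (d n) ≤ x n) : f a ≤ y :=
  hf.isClosed_epigraph.mem_of_tendsto
    (hd.prodMk_nhds ((continuous_coe_real_ereal.tendsto y).comp hx))
    (Filter.Eventually.of_forall hle)

lemma qL_add (hL : IsSN L) (a b : B) : qL L (a + b) = qL L a + qL L b + L a b := by
  have := hL.2 a b
  simp only [qL, map_add, add_apply]
  linarith

lemma qL_sub (hL : IsSN L) (a b : B) : qL L (a - b) = qL L a + qL L b - L a b := by
  have := hL.2 a b
  simp only [qL, map_sub, sub_apply]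
  linarith

lemma qL_smul (t : ℝ) (a : B) : qL L (t • a) = t ^ 2 * qL L a := by
  simp only [qL, map_smul, smul_apply, smul_eq_mul]
  ring

lemma qL_sub_comm (a b : B) : qL L (a - b) = qL L (b - a) := by
  simp only [qL, map_sub, sub_apply]
  ring

lemma continuous_qL : Continuous (qL L) := by
  unfold qL
  fun_prop

lemma IsSN.abs_apply_le (hL : IsSN L) (a b : B) : |L a b| ≤ ‖a‖ * ‖b‖ := by
  have h₁ := L.le_opNorm₂ a b
  rw [Real.norm_eq_abs] at h₁
  have h₂ : ‖L‖ * ‖a‖ * ‖b‖ ≤ 1 * ‖a‖ * ‖b‖ := by gcongr; exact hL.1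
  linarith

lemma abs_qL_le (hL : IsSN L) (a : B) : |qL L a| ≤ (1 / 2) * ‖a‖ ^ 2 := by
  have := hL.abs_apply_le a a
  rw [qL, abs_mul, abs_of_pos (by norm_num : (0 : ℝ) < 1 / 2)]
  nlinarith

lemma rL_nonneg (hL : IsSN L) (a : B) : 0 ≤ rL L a := by
  have := (abs_le.1 (abs_qL_le hL a)).1
  rw [rL]
  linarith

lemma rL_add_le (hL : IsSN L) (a e : B) :
    rL L (a + e) ≤ rL L a + 2 * ‖a‖ * ‖e‖ + ‖e‖ ^ 2 := by
  have h₁ := (abs_le.1 (hL.abs_apply_le a e)).2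
  have h₂ := (abs_le.1 (abs_qL_le hL e)).2
  have h₃ : ‖a + e‖ ^ 2 ≤ (‖a‖ + ‖e‖) ^ 2 := by gcongr; exact norm_add_le a e
  rw [rL, rL, qL_add hL]
  nlinarith

lemma PCq.qL_le (hh : PCq L h) {d : B} {x : ℝ} (hd : h d ≤ x) : qL L d ≤ x :=
  EReal.coe_le_coe_iff.1 ((hh.2.2 d).trans hd)

lemma PCq.qL_convex_comb_le (hh : PCq L h) {d e : B} {x y t : ℝ} (hd : h d ≤ x) (he : h e ≤ y)
    (h₀ : 0 ≤ t) (h₁ : t ≤ 1) : qL L (t • d + (1 - t) • e) ≤ t * x + (1 - t) * y := by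
  refine hh.qL_le ((hh.2.1 d e t h₀ h₁).trans ?_)
  have h₂ : (t : EReal) * h d ≤ (t : EReal) * x :=
    mul_le_mul_of_nonneg_left hd (by exact_mod_cast h₀)
  have h₃ : ((1 - t : ℝ) : EReal) * h e ≤ ((1 - t : ℝ) : EReal) * y :=
    mul_le_mul_of_nonneg_left he (by exact_mod_cast sub_nonneg.2 h₁)
  push_cast at h₂ h₃ ⊢
  exact add_le_add h₂ h₃

lemma PCq.neg_qL_sub_le (hL : IsSN L) (hh : PCq L h) {d e : B} {x y : ℝ} (hd : h d ≤ x)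
    (he : h e ≤ y) : -qL L (d - e) ≤ 2 * (x - qL L d) + 2 * (y - qL L e) := by
  have := hh.qL_convex_comb_le (t := 1 / 2) hd he (by norm_num) (by norm_num)
  rw [qL_add hL, qL_smul, qL_smul] at this
  simp only [map_smul, smul_apply, smul_eq_mul] at this
  rw [qL_sub hL]
  linarith

lemma PCq.ne_bot (hh : PCq L h) (d : B) : h d ≠ ⊥ :=
  ((EReal.bot_lt_coe _).trans_le (hh.2.2 d)).ne'

lemma PCq.eq_qL_iff (hh : PCq L h) {a : B} : h a = qL L a ↔ h a ≤ qL L a :=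
  ⟨le_of_eq, fun H => le_antisymm H (hh.2.2 a)⟩

lemma le_fconj {p : B →L[ℝ] ℝ} {d : B} {x : ℝ} (hd : h d ≤ x) :
    ((p d - x : ℝ) : EReal) ≤ fconj h p := by
  rw [EReal.coe_sub]
  exact (EReal.sub_le_sub le_rfl hd).trans (le_iSup (fun b : B => ((p b : ℝ) : EReal) - h b) d)

lemma fconj_le {p : B →L[ℝ] ℝ} {y : EReal} (hbot : ∀ d, h d ≠ ⊥)
    (H : ∀ (d : B) (x : ℝ), h d ≤ x → ((p d - x : ℝ) : EReal) ≤ y) : fconj h p ≤ y := by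
  refine iSup_le fun d => ?_
  by_cases htop : h d = ⊤
  · rw [htop, EReal.sub_top]
    exact bot_le
  · have hx := EReal.coe_toReal htop (hbot d)
    rw [← hx, ← EReal.coe_sub]
    exact H d _ hx.ge

lemma fconjL_convex (hbot : ∀ d, h d ≠ ⊥) (a b : B) {t : ℝ} (h₀ : 0 ≤ t) (h₁ : t ≤ 1) :
    fconjL L h (t • a + (1 - t) • b) ≤
      (t : EReal) * fconjL L h a + ((1 - t : ℝ) : EReal) * fconjL L h b := by
  refine fconj_le hbot fun d x hd => ?_
  have h₂ : (t : EReal) * ((L a d - x : ℝ) : EReal) ≤ (t : EReal) * fconjL L h a :=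
    mul_le_mul_of_nonneg_left (le_fconj hd) (by exact_mod_cast h₀)
  have h₃ : ((1 - t : ℝ) : EReal) * ((L b d - x : ℝ) : EReal) ≤
      ((1 - t : ℝ) : EReal) * fconjL L h b :=
    mul_le_mul_of_nonneg_left (le_fconj hd) (by exact_mod_cast sub_nonneg.2 h₁)
  refine le_trans (le_of_eq ?_) (add_le_add h₂ h₃)
  rw [← EReal.coe_mul, ← EReal.coe_mul, ← EReal.coe_add]
  simp only [map_add, map_smul, add_apply, smul_apply,
    smul_eq_mul]
  congr 1
  ring

lemma PCq.fconjL_le_qL (hL : IsSN L) (hh : PCq L h) {a : B} (ha : h a ≤ qL L a) :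
    fconjL L h a ≤ qL L a := by
  refine fconj_le hh.ne_bot fun d x hd => EReal.coe_le_coe_iff.2 ?_
  have key : ∀ t : ℝ, 0 < t → t ≤ 1 → L a d - x ≤ qL L a + t * (L a d - qL L a - qL L d) := by
    intro t h₀ h₁
    have := hh.qL_convex_comb_le hd ha h₀.le h₁
    rw [qL_add hL, qL_smul, qL_smul] at this
    simp only [map_smul, smul_apply, smul_eq_mul] at this
    rw [hL.2 a d] at this
    refine le_of_mul_le_mul_left ?_ h₀
    linarith
  have hlim : Filter.Tendsto (fun t : ℝ => qL L a + t * (L a d - qL L a - qL L d))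
      (nhdsWithin 0 (Set.Ioi 0)) (nhds (qL L a)) := by
    have : Continuous (fun t : ℝ => qL L a + t * (L a d - qL L a - qL L d)) := by fun_prop
    simpa using (this.tendsto 0).mono_left nhdsWithin_le_nhds
  refine ge_of_tendsto hlim ?_
  filter_upwards [Ioc_mem_nhdsGT (zero_lt_one' ℝ)] with t ht using key t ht.1 ht.2

lemma PCq.isClosed_contact (hh : PCq L h) (hlsc : LowerSemicontinuous h) :
    IsClosed {b : B | h b = (qL L b : EReal)} := by
  simp only [hh.eq_qL_iff]
  refine IsSeqClosed.isClosed fun d a hd ha => ?_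
  exact hlsc.le_of_tendsto_of_le ha ((continuous_qL.tendsto a).comp ha) hd

lemma PCq.qL_sub_nonneg_of_contact (hL : IsSN L) (hh : PCq L h) {a c : B}
    (ha : h a = qL L a) (hc : h c = qL L c) : 0 ≤ qL L (a - c) := by
  have := hh.neg_qL_sub_le hL ha.le hc.le
  linarith

lemma Touching.exists_lt (ht : Touching L h) (c : B) {ε : ℝ} (hε : 0 < ε) :
    ∃ p : B × ℝ, h p.1 ≤ p.2 ∧ p.2 - qL L p.1 + rL L (p.1 - c) < ε := by
  have h₁ := (ht.2 c).trans_lt (show (0 : EReal) < (ε : EReal) by exact_mod_cast hε)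
  obtain ⟨d, hd⟩ := iInf_lt_iff.1 h₁
  have htop : h d ≠ ⊤ := by
    intro H
    rw [H, EReal.top_sub_coe, EReal.top_add_coe] at hd
    exact not_top_lt hd
  have hx := EReal.coe_toReal htop (ht.1.ne_bot d)
  refine ⟨(d, (h d).toReal), hx.ge, ?_⟩
  rw [← hx] at hd
  exact_mod_cast hd

lemma Touching.exists_contact_near [CompleteSpace B] (hL : IsSN L) (hlsc : LowerSemicontinuous h)
    (ht : Touching L h) {η : ℝ} (hη : 0 < η) {d : B} {x : ℝ} (hd : h d ≤ x)
    (hx : x - qL L d ≤ (η / 6) ^ 2) :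
    ∃ a, h a = qL L a ∧ ‖a - d‖ ≤ η := by
  choose F hF₁ hF₂ using fun (n : ℕ) (c : B) =>
    ht.exists_lt c (ε := (η / 6) ^ 2 / 4 ^ (n + 1)) (by positivity)
  let p : ℕ → B × ℝ := fun n => Nat.rec (d, x) (fun n q => F n q.1) n
  have hp₁ : ∀ n, h (p n).1 ≤ (p n).2 := by
    rintro (_ | n)
    · exact hd
    · exact hF₁ n _
  have hp₂ : ∀ n, (p n).2 - qL L (p n).1 ≤ (η / 6) ^ 2 / 4 ^ n := by
    rintro (_ | n)
    · simpa [p] using hx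
    · have h₁ := hF₂ n (p n).1
      have h₂ := rL_nonneg hL ((F n (p n).1).1 - (p n).1)
      change (F n (p n).1).2 - qL L (F n (p n).1).1 ≤ _
      linarith
  have hdist : ∀ n, dist (p n).1 (p (n + 1)).1 ≤ η / 2 / 2 ^ n := by
    intro n
    have h₁ : (p (n + 1)).2 - qL L (p (n + 1)).1 + rL L ((p (n + 1)).1 - (p n).1) <
      (η / 6) ^ 2 / 4 ^ (n + 1) := hF₂ n (p n).1
    have h₂ := ht.1.neg_qL_sub_le hL (hp₁ (n + 1)) (hp₁ n)
    have h₃ := hp₂ n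
    have h₄ := ht.1.qL_le (hp₁ (n + 1))
    have h₅ := rL_nonneg hL ((p (n + 1)).1 - (p n).1)
    have h₆ : (η / 6) ^ 2 / 4 ^ (n + 1) = (η / 6) ^ 2 / 4 ^ n / 4 := by
      rw [pow_succ (4 : ℝ), div_mul_eq_div_div]
    have h₇ : (η / 2 / 2 ^ n) ^ 2 = 9 * ((η / 6) ^ 2 / 4 ^ n) := by
      rw [div_pow, ← pow_mul, mul_comm n 2, pow_mul]
      norm_num
      ring
    have h₈ : 0 < (η / 6) ^ 2 / 4 ^ n := by positivity
    rw [dist_comm, dist_eq_norm]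
    refine le_of_sq_le_sq ?_ (by positivity)
    rw [rL] at h₁ h₅
    rw [h₇]
    linarith
  obtain ⟨a, ha⟩ := cauchySeq_tendsto_of_complete (cauchySeq_of_le_geometric_two hdist)
  refine ⟨a, ht.1.eq_qL_iff.2 ?_, ?_⟩
  · refine hlsc.le_of_tendsto_of_le
      (x := fun n => qL L (p n).1 + (η / 6) ^ 2 / 4 ^ n) ha ?_ fun n => (hp₁ n).trans ?_
    · have h₁ : Filter.Tendsto (fun n : ℕ => (η / 6) ^ 2 / (4 : ℝ) ^ n) Filter.atTop (nhds 0) :=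
        tendsto_const_nhds.div_atTop (tendsto_pow_atTop_atTop_of_one_lt (by norm_num))
      simpa using ((continuous_qL.tendsto a).comp ha).add h₁
    · have := hp₂ n
      exact EReal.coe_le_coe_iff.2 (by linarith)
  · rw [← dist_eq_norm, dist_comm]
    exact dist_le_of_le_geometric_two_of_tendsto₀ hdist ha

lemma Touching.contact_nonempty [CompleteSpace B] (hL : IsSN L) (hlsc : LowerSemicontinuous h)
    (ht : Touching L h) : ({b : B | h b = (qL L b : EReal)}).Nonempty := by
  obtain ⟨p, hp₁, hp₂⟩ := ht.exists_lt 0 (ε := (1 / 6) ^ 2) (by norm_num)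
  have := rL_nonneg hL (p.1 - 0)
  obtain ⟨a, ha, -⟩ := ht.exists_contact_near hL hlsc one_pos hp₁ (by linarith)
  exact ⟨a, ha⟩

lemma PCq.norm_sub_le_of_contact (hL : IsSN L) (hh : PCq L h) {a c d : B} {x : ℝ}
    (ha : h a = qL L a) (hd : h d ≤ x) (hx : x - qL L d + rL L (d - c) ≤ 1) :
    ‖d - c‖ ≤ 3 * ‖a - c‖ + 3 := by
  have h₁ := hh.neg_qL_sub_le hL hd ha.le
  have h₂ := rL_nonneg hL (d - c)
  have h₃ := hh.qL_le hd
  have h₄ := (abs_le.1 (hL.abs_apply_le (d - a) (a - c))).1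
  have h₅ := (abs_le.1 (abs_qL_le hL (a - c))).1
  have h₆ : qL L (d - c) = qL L (d - a) + qL L (a - c) + L (d - a) (a - c) := by
    rw [← qL_add hL, sub_add_sub_cancel]
  have h₇ : ‖d - a‖ * ‖a - c‖ ≤ (‖d - c‖ + ‖a - c‖) * ‖a - c‖ := by
    gcongr
    rw [← sub_sub_sub_cancel_right d a c]
    exact norm_sub_le _ _
  have h₈ := norm_nonneg (a - c)
  rw [rL] at hx h₂
  by_contra! H
  nlinarith

lemma Touching.exists_contact_rL_le [CompleteSpace B] (hL : IsSN L)
    (hlsc : LowerSemicontinuous h) (ht : Touching L h) (c : B) :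
    ∃ K : ℝ, 0 ≤ K ∧ ∀ ε : ℝ, 0 < ε →
      ∃ a, h a = qL L a ∧ ‖a - c‖ ≤ K ∧ rL L (a - c) ≤ ε := by
  obtain ⟨a₀, ha₀⟩ := ht.contact_nonempty hL hlsc
  set S := 3 * ‖a₀ - c‖ + 3 with hS
  have hS₀ : 0 < S := by positivity
  refine ⟨S + 1, by positivity, fun ε hε => ?_⟩
  set η := min 1 (ε / (2 * (2 * S + 1))) with hη_def
  have hη : 0 < η := by positivity
  have hη₁ : η ≤ 1 := min_le_left _ _
  have hη₂ : (2 * S + 1) * η ≤ ε / 2 := by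
    have : η ≤ ε / (2 * (2 * S + 1)) := min_le_right _ _
    rw [le_div_iff₀ (by positivity)] at this
    linarith
  obtain ⟨⟨d, x⟩, hd, hx⟩ :=
    ht.exists_lt c (ε := min 1 (min (ε / 2) ((η / 6) ^ 2))) (by positivity)
  simp only [lt_min_iff] at hd hx
  obtain ⟨hx₁, hx₂, hx₃⟩ := hx
  have hr := rL_nonneg hL (d - c)
  have hq := ht.1.qL_le hd
  obtain ⟨a, ha, had⟩ := ht.exists_contact_near hL hlsc hη hd (by linarith)
  have hdc : ‖d - c‖ ≤ S := ht.1.norm_sub_le_of_contact hL ha₀ hd hx₁.le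
  have hac : a - c = (d - c) + (a - d) := by abel
  refine ⟨a, ha, ?_, ?_⟩
  · rw [hac]
    exact (norm_add_le _ _).trans (by linarith)
  · have h₁ := rL_add_le hL (d - c) (a - d)
    have h₂ : ‖d - c‖ * ‖a - d‖ ≤ S * η := by gcongr
    have h₃ : ‖a - d‖ ^ 2 ≤ η ^ 2 := by gcongr
    rw [hac]
    nlinarith

lemma mem_closure_of_qL_sub_nonneg {A : Set B} {b : B}
    (hA : ∀ ε : ℝ, 0 < ε → ∃ a ∈ A, rL L (a - b) ≤ ε) (hb : ∀ a ∈ A, 0 ≤ qL L (a - b)) :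
    b ∈ closure A := by
  refine Metric.mem_closure_iff.2 fun ε hε => ?_
  obtain ⟨a, ha, hr⟩ := hA (ε ^ 2 / 4) (by positivity)
  refine ⟨a, ha, ?_⟩
  have := hb a ha
  rw [rL] at hr
  rw [dist_comm, dist_eq_norm]
  refine lt_of_pow_lt_pow_left₀ 2 hε.le ?_
  nlinarith

lemma Touching.qL_le_fconjL (hL : IsSN L) (ht : Touching L h) (b : B) :
    (qL L b : EReal) ≤ fconjL L h b := by
  refine EReal.coe_le_of_forall_pos_sub_le fun ε hε => ?_
  obtain ⟨⟨d, x⟩, hd, hx⟩ := ht.exists_lt b hε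
  refine le_trans (EReal.coe_le_coe_iff.2 ?_) (le_fconj (p := L b) hd)
  simp only [rL, qL_sub hL, hL.2 b d] at hx
  nlinarith [sq_nonneg ‖d - b‖]

lemma Touching.contact_of_fconjL_eq [CompleteSpace B] (hL : IsSN L)
    (hlsc : LowerSemicontinuous h) (ht : Touching L h) {b : B}
    (hb : fconjL L h b = qL L b) : h b = qL L b := by
  have hcl := ht.1.isClosed_contact hlsc
  suffices b ∈ closure {b : B | h b = (qL L b : EReal)} by rwa [hcl.closure_eq] at this
  refine Metric.mem_closure_iff.2 fun ε hε => ?_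
  obtain ⟨⟨d, x⟩, hd, hx⟩ := ht.exists_lt b (ε := (ε / 3 / 6) ^ 2) (by positivity)
  simp only at hd hx
  have hr := rL_nonneg hL (d - b)
  obtain ⟨a, ha, had⟩ := ht.exists_contact_near hL hlsc (by positivity : 0 < ε / 3) hd
    (by linarith)
  have h₁ : L b d - x ≤ qL L b := by
    have := le_fconj (p := L b) hd
    rw [← EReal.coe_le_coe_iff, ← hb]
    exact this
  have h₂ : ‖d - b‖ ≤ ε / 3 := by
    refine le_of_sq_le_sq ?_ (by positivity)
    rw [rL, qL_sub hL, ← hL.2 d b] at hx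
    nlinarith
  refine ⟨a, ha, ?_⟩
  rw [dist_comm, dist_eq_norm, ← sub_add_sub_cancel a d b]
  linarith [norm_add_le (a - d) (d - b)]

end BanachSN

theorem statement4 [CompleteSpace B] [Nontrivial B]
    (L : B →L[ℝ] (B →L[ℝ] ℝ)) (hL : IsSN L)
    (h : B → EReal) (hh : PCq L h) (hlsc : LowerSemicontinuous h)
    (htouch : Touching L h) :
    (∀ b : B, (qL L b : EReal) ≤ fconjL L h b) ∧
    ({b : B | fconjL L h b = (qL L b : EReal)} = {b : B | h b = (qL L b : EReal)} ∧
      ({b : B | h b = (qL L b : EReal)}).Nonempty ∧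
      IsClosed {b : B | h b = (qL L b : EReal)} ∧
      StablyRDense L {b : B | h b = (qL L b : EReal)} ∧
      MaxLPositive L {b : B | h b = (qL L b : EReal)}) ∧
    Touching L (fconjL L h) := by
  have hclosed := hh.isClosed_contact hlsc
  have heq : ∀ {a : B}, h a = qL L a → fconjL L h a = qL L a := fun {a} ha =>
    le_antisymm (hh.fconjL_le_qL hL ha.le) (htouch.qL_le_fconjL hL a)
  have hne := htouch.contact_nonempty hL hlsc
  have hdense := htouch.exists_contact_rL_le hL hlsc
  refine ⟨htouch.qL_le_fconjL hL, ⟨?_, hne, hclosed, ?_, ⟨hne, ?_⟩, ?_⟩, ⟨?_, ?_, ?_⟩, ?_⟩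
  · ext b
    exact ⟨htouch.contact_of_fconjL_eq hL hlsc, heq⟩
  · intro c
    obtain ⟨K, hK, H⟩ := hdense c
    refine ⟨K, hK, EReal.nonpos_of_forall_pos_le fun ε hε => ?_⟩
    obtain ⟨a, ha, haK, har⟩ := H ε hε
    exact (iInf₂_le a ⟨ha, haK⟩).trans (EReal.coe_le_coe_iff.2 har)
  · intro a ha c hc
    exact hh.qL_sub_nonneg_of_contact hL ha hc
  · intro A' hA' hsub
    refine Set.Subset.antisymm (fun b hb => ?_) hsub
    rw [← hclosed.closure_eq]
    refine mem_closure_of_qL_sub_nonneg (L := L) (fun ε hε => ?_)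
      fun a ha => hA'.2 a (hsub ha) b hb
    obtain ⟨K, -, H⟩ := hdense b
    obtain ⟨a, ha, -, har⟩ := H ε hε
    exact ⟨a, ha, har⟩
  · obtain ⟨a, ha⟩ := hne
    exact ⟨a, by rw [heq ha]; exact EReal.coe_ne_top _⟩
  · exact fun a b t h₀ h₁ => fconjL_convex hh.ne_bot a b h₀ h₁
  · exact htouch.qL_le_fconjL hL
  · intro c
    refine EReal.nonpos_of_forall_pos_le fun ε hε => ?_
    obtain ⟨K, -, H⟩ := hdense c
    obtain ⟨a, ha, -, har⟩ := H ε hε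
    refine (iInf_le _ a).trans ?_
    rw [heq ha, ← EReal.coe_sub, ← EReal.coe_add, sub_self, zero_add]
    exact EReal.coe_le_coe_iff.2 har
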